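/- arXiv:2301.05758 — 2 statements merged into one kernel-verified Lean document; each statement's English description precedes it below -/
import Mathlib

section
/- Let P be the Pell sequence (P_0 = 0, P_1 = 1, P_n = 2P_{n-1} + P_{n-2}) and Q the associated Pell sequence (Q_0 = 1, Q_1 = 1, Q_n = 2Q_{n-1} + Q_{n-2}). Define σ_Q(k,n) = Σ_{i=1}^{k} Q_{n+i}. For all k ≥ 1 with k even and all n ≥ 0: σ_Q(k,n) = P_{n+k+1} − P_{n+1}; moreover if k ≡ 0 (mod 4) then σ_Q(k,n) = 2·P_{k/2}·Q_{k/2+n+1}, and if k ≡ 2 (mod 4) then σ_Q(k,n) = 2·Q_{k/2}·P_{k/2+n+1}. -/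
/-- The Pell sequence: P₀ = 0, P₁ = 1, Pₙ = 2Pₙ₋₁ + Pₙ₋₂. -/
def pell : ℕ → ℤ
  | 0 => 0
  | 1 => 1
  | n + 2 => 2 * pell (n + 1) + pell n

/-- The associated Pell sequence: Q₀ = 1, Q₁ = 1, Qₙ = 2Qₙ₋₁ + Qₙ₋₂. -/
def assocPell : ℕ → ℤ
  | 0 => 1
  | 1 => 1
  | n + 2 => 2 * assocPell (n + 1) + assocPell n

theorem pell_assocPell_succ (n : ℕ) :
    pell (n + 1) = pell n + assocPell n ∧ assocPell (n + 1) = assocPell n + 2 * pell n := by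
  induction n with
  | zero => simp [pell, assocPell]
  | succ n ih =>
    obtain ⟨hP, hQ⟩ := ih
    rw [pell, assocPell]
    constructor <;> linarith

theorem pell_assocPell_add (m n : ℕ) :
    pell (m + n) = pell m * assocPell n + assocPell m * pell n ∧
      assocPell (m + n) = assocPell m * assocPell n + 2 * pell m * pell n := by
  induction n with
  | zero => simp [pell, assocPell]
  | succ n ih =>
    obtain ⟨hP, hQ⟩ := ih
    rw [← add_assoc, (pell_assocPell_succ (m + n)).1, (pell_assocPell_succ (m + n)).2,
      (pell_assocPell_succ n).1, (pell_assocPell_succ n).2, hP, hQ]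
    constructor <;> ring

theorem assocPell_sq_sub_two_mul_pell_sq (n : ℕ) :
    assocPell n ^ 2 - 2 * pell n ^ 2 = (-1) ^ n := by
  induction n with
  | zero => simp [pell, assocPell]
  | succ n ih =>
    rw [(pell_assocPell_succ n).1, (pell_assocPell_succ n).2, pow_succ (-1), ← ih]
    ring

theorem pell_add_two_mul_sub (m h : ℕ) :
    pell (m + 2 * h) - (-1) ^ h * pell m = 2 * pell h * assocPell (m + h) := by
  rw [two_mul, ← add_assoc, (pell_assocPell_add (m + h) h).1, (pell_assocPell_add m h).1,
    (pell_assocPell_add m h).2, ← assocPell_sq_sub_two_mul_pell_sq]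
  ring

theorem pell_add_two_mul_add (m h : ℕ) :
    pell (m + 2 * h) + (-1) ^ h * pell m = 2 * assocPell h * pell (m + h) := by
  rw [two_mul, ← add_assoc, (pell_assocPell_add (m + h) h).1, (pell_assocPell_add m h).1,
    (pell_assocPell_add m h).2, ← assocPell_sq_sub_two_mul_pell_sq]
  ring

theorem sum_assocPell (k n : ℕ) :
    ∑ i ∈ Finset.Icc 1 k, assocPell (n + i) = pell (n + k + 1) - pell (n + 1) := by
  induction k with
  | zero => simp
  | succ k ih =>
    rw [Finset.sum_Icc_succ_top (by omega), ih, (pell_assocPell_succ (n + (k + 1))).1]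
    simp only [← add_assoc]
    ring

theorem sigma_assocPell (k n : ℕ) (hk : 1 ≤ k) (hke : k % 2 = 0) :
    (∑ i ∈ Finset.Icc 1 k, assocPell (n + i)) = pell (n + k + 1) - pell (n + 1) ∧
    (k % 4 = 0 →
      ∑ i ∈ Finset.Icc 1 k, assocPell (n + i) = 2 * pell (k / 2) * assocPell (k / 2 + n + 1)) ∧
    (k % 4 = 2 →
      ∑ i ∈ Finset.Icc 1 k, assocPell (n + i) = 2 * assocPell (k / 2) * pell (k / 2 + n + 1)) := by
  rw [sum_assocPell]
  have hend : n + 1 + 2 * (k / 2) = n + k + 1 := by omega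
  have hmid : n + 1 + k / 2 = k / 2 + n + 1 := by omega
  refine ⟨rfl, fun h4 => ?_, fun h4 => ?_⟩
  · have hpow : (-1 : ℤ) ^ (k / 2) = 1 := Even.neg_one_pow (Nat.even_iff.mpr (by omega))
    have key := pell_add_two_mul_sub (n + 1) (k / 2)
    rwa [hpow, one_mul, hend, hmid] at key
  · have hpow : (-1 : ℤ) ^ (k / 2) = -1 := Odd.neg_one_pow (Nat.odd_iff.mpr (by omega))
    have key := pell_add_two_mul_add (n + 1) (k / 2)
    rwa [hpow, neg_one_mul, ← sub_eq_add_neg, hend, hmid] at key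
end

section
/- Let P be the Pell sequence (P_0 = 0, P_1 = 1, P_n = 2P_{n-1} + P_{n-2}) and Q the associated Pell sequence (Q_0 = 1, Q_1 = 1, Q_n = 2Q_{n-1} + Q_{n-2}). For every k ≥ 1, the greatest common divisor of the set { Σ_{i=1}^{k} P_{n+i} : n ≥ 0 } of all sums of k consecutive Pell numbers equals 2·P_{k/2} if k ≡ 0 (mod 4), equals Q_{k/2} if k ≡ 2 (mod 4), and equals 1 if k is odd. -/
/-- `d` is the greatest common divisor of the set `{S n : n ≥ 0}`: `d ≥ 1`, `d` divides
every element of the set, and every common divisor of the set divides `d`. -/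
def IsSetGCD (S : ℕ → ℤ) (d : ℤ) : Prop :=
  1 ≤ d ∧ (∀ n : ℕ, d ∣ S n) ∧ ∀ e : ℤ, (∀ n : ℕ, e ∣ S n) → e ∣ d

theorem pell_add_two (n : ℕ) : pell (n + 2) = 2 * pell (n + 1) + pell n := rfl

theorem assocPell_add_two (n : ℕ) :
    assocPell (n + 2) = 2 * assocPell (n + 1) + assocPell n := rfl

theorem pell_add (m n : ℕ) :
    pell (m + n) = pell m * pell (n + 1) + pell (m + 1) * pell n - 2 * pell m * pell n := by
  induction n using Nat.twoStepInduction with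
  | zero => simp [pell]
  | one => simp [pell]; ring
  | more n ih₀ ih₁ =>
    rw [← add_assoc, pell_add_two, add_assoc m n 1, ih₀, ih₁, pell_add_two (n + 1),
      pell_add_two n]
    ring

theorem pell_cassini (n : ℕ) :
    pell (n + 1) ^ 2 - 2 * pell (n + 1) * pell n - pell n ^ 2 = (-1) ^ n := by
  induction n with
  | zero => simp [pell]
  | succ n ih => rw [pow_succ (-1 : ℤ), ← ih, pell_add_two]; ring

theorem assocPell_eq_pell_succ_sub (n : ℕ) : assocPell n = pell (n + 1) - pell n := by
  induction n using Nat.twoStepInduction with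
  | zero => simp [pell, assocPell]
  | one => simp [pell, assocPell]
  | more n ih₀ ih₁ =>
    rw [assocPell_add_two, ih₀, ih₁, pell_add_two (n + 1), pell_add_two n]
    ring

theorem pell_nonneg (n : ℕ) : 0 ≤ pell n := by
  induction n using Nat.twoStepInduction with
  | zero => simp [pell]
  | one => simp [pell]
  | more n ih₀ ih₁ => rw [pell_add_two]; linarith

theorem one_le_pell_succ (n : ℕ) : 1 ≤ pell (n + 1) := by
  induction n with
  | zero => simp [pell]
  | succ n ih => linarith [pell_add_two n, pell_nonneg n]

theorem one_le_assocPell (n : ℕ) : 1 ≤ assocPell n := by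
  induction n using Nat.twoStepInduction with
  | zero => simp [assocPell]
  | one => simp [assocPell]
  | more n ih₀ ih₁ => linarith [assocPell_add_two n]

theorem odd_pell_of_odd {n : ℕ} (hn : Odd n) : Odd (pell n) := by
  obtain ⟨t, rfl⟩ := hn
  induction t with
  | zero => simp [pell]
  | succ t ih => exact (even_two_mul _).add_odd ih

theorem isCoprime_succ_of_recurrence {u : ℕ → ℤ} (h : ∀ n, u (n + 2) = 2 * u (n + 1) + u n)
    (h₀ : IsCoprime (u 0) (u 1)) (n : ℕ) : IsCoprime (u n) (u (n + 1)) := by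
  induction n with
  | zero => exact h₀
  | succ n ih =>
    obtain ⟨a, b, hab⟩ := ih
    exact ⟨b - 2 * a, a, by rw [h]; linear_combination hab⟩

theorem isCoprime_pell_succ (n : ℕ) : IsCoprime (pell n) (pell (n + 1)) :=
  isCoprime_succ_of_recurrence pell_add_two isCoprime_one_right n

theorem isCoprime_assocPell_succ (n : ℕ) : IsCoprime (assocPell n) (assocPell (n + 1)) :=
  isCoprime_succ_of_recurrence assocPell_add_two isCoprime_one_right n

theorem isSetGCD_mul {S u : ℕ → ℤ} {c : ℤ} (hc : 1 ≤ c) (hS : ∀ n, S n = c * u n)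
    (hu : IsCoprime (u 0) (u 1)) : IsSetGCD S c := by
  refine ⟨hc, fun n => ⟨u n, hS n⟩, fun e he => ?_⟩
  obtain ⟨a, b, hab⟩ := hu
  have key : c = a * S 0 + b * S 1 := by
    rw [hS, hS]
    linear_combination -c * hab
  rw [key]
  exact dvd_add ((he 0).mul_left a) ((he 1).mul_left b)

theorem two_mul_sum_pell (n k : ℕ) :
    2 * ∑ i ∈ Finset.Icc 1 k, pell (n + i) =
      pell (n + k + 1) + pell (n + k) - pell (n + 1) - pell n := by
  induction k with
  | zero => simp
  | succ k ih =>
    rw [Finset.sum_Icc_succ_top (by omega), mul_add, ih, ← add_assoc, pell_add_two]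
    ring

theorem sum_pell_two_mul_of_even (n : ℕ) {m : ℕ} (hm : Even m) :
    ∑ i ∈ Finset.Icc 1 (2 * m), pell (n + i) = 2 * pell m * pell (n + 1 + m) := by
  have hs := two_mul_sum_pell n (2 * m)
  have hc := pell_cassini m
  rw [hm.neg_one_pow] at hc
  have h₁ := pell_add (n + m + 1) m
  have h₂ := pell_add (n + m) m
  have h₃ := pell_add n m
  have h₄ := pell_add (n + 1) m
  have e₁ : n + 2 * m + 1 = n + m + 1 + m := by ring
  have e₂ : n + 2 * m = n + m + m := by ring
  have e₃ : n + m + 1 = n + 1 + m := by ring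
  rw [e₁, e₂, h₁, h₂, pell_add_two (n + m), e₃, h₃, h₄, pell_add_two n] at hs
  rw [h₄, pell_add_two n]
  linarith [congrArg ((pell n + pell (n + 1)) * ·) hc]

theorem sum_pell_two_mul_of_odd (n : ℕ) {m : ℕ} (hm : Odd m) :
    ∑ i ∈ Finset.Icc 1 (2 * m), pell (n + i) = assocPell m * assocPell (n + 1 + m) := by
  have hs := two_mul_sum_pell n (2 * m)
  have hc := pell_cassini m
  rw [hm.neg_one_pow] at hc
  have h₁ := pell_add (n + m + 1) m
  have h₂ := pell_add (n + m) m
  have h₃ := pell_add n m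
  have h₄ := pell_add (n + 1) m
  have e₁ : n + 2 * m + 1 = n + m + 1 + m := by ring
  have e₂ : n + 2 * m = n + m + m := by ring
  have e₃ : n + m + 1 = n + 1 + m := by ring
  have h₅ : pell (n + 1 + m + 1) = 2 * pell (n + 1 + m) + pell (n + m) := by
    rw [← e₃, pell_add_two]
  rw [e₁, e₂, h₁, h₂, pell_add_two (n + m), e₃, h₃, h₄, pell_add_two n] at hs
  rw [assocPell_eq_pell_succ_sub, assocPell_eq_pell_succ_sub, h₅, h₃, h₄, pell_add_two n]
  linarith [congrArg ((pell n + pell (n + 1)) * ·) hc]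

theorem sum_pell_succ_sub (n k : ℕ) :
    ∑ i ∈ Finset.Icc 1 k, pell (n + 1 + i) - ∑ i ∈ Finset.Icc 1 k, pell (n + i) =
      pell (n + k + 1) - pell (n + 1) := by
  induction k with
  | zero => simp
  | succ k ih =>
    rw [Finset.sum_Icc_succ_top (by omega), Finset.sum_Icc_succ_top (by omega),
      show n + 1 + (k + 1) = n + (k + 1) + 1 by ring, ← add_assoc n k 1]
    linear_combination ih

theorem isSetGCD_sum_pell_of_odd {k : ℕ} (hk : Odd k) :
    IsSetGCD (fun n => ∑ i ∈ Finset.Icc 1 k, pell (n + i)) 1 := by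
  refine ⟨le_rfl, fun n => one_dvd _, fun e he => ?_⟩
  have h₁ : e ∣ pell (k + 1) - 1 := by
    have h := dvd_sub (he 1) (he 0)
    have hd := sum_pell_succ_sub 0 k
    simp only [zero_add] at h hd
    rwa [hd] at h
  have h₂ : e ∣ pell (k + 2) - 2 := by
    have h := dvd_sub (he 2) (he 1)
    have hd := sum_pell_succ_sub 1 k
    rw [show 1 + k + 1 = k + 2 by ring] at hd
    exact hd ▸ h
  have h₃ : e ∣ pell k := by
    have h := dvd_sub h₂ (h₁.mul_left 2)
    rwa [pell_add_two, show 2 * pell (k + 1) + pell k - 2 - 2 * (pell (k + 1) - 1) = pell k by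
      ring] at h
  have hc := pell_cassini k
  rw [hk.neg_one_pow] at hc
  have h_two : e ∣ 2 := by
    have h := dvd_sub (h₃.mul_left (2 * pell (k + 1) + pell k)) (h₁.mul_left (pell (k + 1) + 1))
    rwa [show (2 * pell (k + 1) + pell k) * pell k - (pell (k + 1) + 1) * (pell (k + 1) - 1) = 2 by
      linear_combination -hc] at h
  obtain ⟨t, ht⟩ := odd_pell_of_odd hk
  have h := dvd_sub h₃ (h_two.mul_right t)
  rwa [ht, add_sub_cancel_left] at h

theorem gcd_sums_pell (k : ℕ) (hk : 1 ≤ k) :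
    (k % 4 = 0 →
      IsSetGCD (fun n => ∑ i ∈ Finset.Icc 1 k, pell (n + i)) (2 * pell (k / 2))) ∧
    (k % 4 = 2 →
      IsSetGCD (fun n => ∑ i ∈ Finset.Icc 1 k, pell (n + i)) (assocPell (k / 2))) ∧
    (Odd k →
      IsSetGCD (fun n => ∑ i ∈ Finset.Icc 1 k, pell (n + i)) 1) := by
  refine ⟨fun h => ?_, fun h => ?_, isSetGCD_sum_pell_of_odd⟩
  · obtain ⟨m, rfl⟩ : ∃ m, k = 2 * m := ⟨k / 2, by omega⟩
    rw [Nat.mul_div_cancel_left m two_pos]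
    obtain ⟨j, rfl⟩ : ∃ j, m = j + 1 := ⟨m - 1, by omega⟩
    refine isSetGCD_mul (u := fun n => pell (n + 1 + (j + 1)))
      (by linarith [one_le_pell_succ j])
      (fun n => sum_pell_two_mul_of_even n (Nat.even_iff.mpr (by omega))) ?_
    convert isCoprime_pell_succ (j + 2) using 2 <;> ring
  · obtain ⟨m, rfl⟩ : ∃ m, k = 2 * m := ⟨k / 2, by omega⟩
    rw [Nat.mul_div_cancel_left m two_pos]
    refine isSetGCD_mul (u := fun n => assocPell (n + 1 + m)) (one_le_assocPell m)
      (fun n => sum_pell_two_mul_of_odd n (Nat.odd_iff.mpr (by omega))) ?_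
    convert isCoprime_assocPell_succ (m + 1) using 2 <;> ring
end
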